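/- For σ > 0 and μ ∈ ℝ, the squared L² norm of the Gaussian difference under a small multiplicative shift satisfies: as a function of ε, both N(ε) = ∫ g(x; 1+ε)² dx and n(ε) = c_1(1+ε)² vanish to second order at ε = 0, and by two applications of L'Hôpital's rule, lim_{ε→0} n(ε)/N(ε) = n''(0)/N''(0) = (√π μ²/σ) / (√π μ²/σ + 3σ√π/2). -/

import Mathlib

open Real MeasureTheory

/-- The `n`-th physicist's Hermite polynomial, via the Rodrigues formula. -/
noncomputable def physHermite (n : ℕ) (x : ℝ) : ℝ :=
  (-1 : ℝ) ^ n * Real.exp (x ^ 2) * iteratedDeriv n (fun t : ℝ => Real.exp (-t ^ 2)) x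

/-- The generalized Hermite-Gaussian function `ψ_n(x; μ, σ)`. -/
noncomputable def hermiteGaussian (n : ℕ) (μ σ x : ℝ) : ℝ :=
  (Real.sqrt (σ * 2 ^ n * n.factorial * Real.sqrt Real.pi))⁻¹ *
    physHermite n ((x - μ) / σ) * Real.exp (-(x - μ) ^ 2 / (2 * σ ^ 2))

/-- The difference between a Gaussian and its Doppler-shifted version. -/
noncomputable def dopplerDiff (μ σ ξ x : ℝ) : ℝ :=
  Real.exp (-(x - μ) ^ 2 / (2 * σ ^ 2)) - Real.exp (-(ξ * x - μ) ^ 2 / (2 * σ ^ 2))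

/-- The Hermite-Gaussian expansion coefficients `c_n(ξ)` of `g(·; ξ)`. -/
noncomputable def hgCoeff (n : ℕ) (μ σ ξ : ℝ) : ℝ :=
  ∫ x : ℝ, hermiteGaussian n μ σ x * dopplerDiff μ σ ξ x

/-- `n(ε) = c₁(1+ε)²`. -/
noncomputable def c1SqFun (μ σ ε : ℝ) : ℝ := (hgCoeff 1 μ σ (1 + ε)) ^ 2

/-- `N(ε) = ∫ g(x; 1+ε)² dx`. -/
noncomputable def normSqFun (μ σ ε : ℝ) : ℝ :=
  ∫ x : ℝ, (dopplerDiff μ σ (1 + ε) x) ^ 2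

lemma aux_int (a m d : ℝ) (ha : 0 < a) :
    Integrable (fun x : ℝ => Real.exp (-a * (x - m) ^ 2 + d)) := by
  have h := ((integrable_exp_neg_mul_sq ha).comp_sub_right m).mul_const (Real.exp d)
  refine h.congr (Filter.Eventually.of_forall fun x => ?_)
  simp only [Real.exp_add]

lemma aux_val (a m d : ℝ) :
    ∫ x : ℝ, Real.exp (-a * (x - m) ^ 2 + d) = Real.sqrt (π / a) * Real.exp d := by
  simp only [Real.exp_add]
  rw [integral_mul_const, integral_sub_right_eq_self (fun x : ℝ => Real.exp (-a * x ^ 2)) m,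
    integral_gaussian]

lemma aux_odd (a : ℝ) : ∫ x : ℝ, x * Real.exp (-a * x ^ 2) = 0 := by
  have h := integral_neg_eq_self (fun x : ℝ => x * Real.exp (-a * x ^ 2)) volume
  simp only [neg_sq, neg_mul] at h
  rw [integral_neg] at h
  simp only [neg_mul]
  linarith

lemma aux_int1 (a m d μ : ℝ) (ha : 0 < a) :
    Integrable (fun x : ℝ => (x - μ) * Real.exp (-a * (x - m) ^ 2 + d)) := by
  have h := ((integrable_mul_exp_neg_mul_sq ha).comp_sub_right m).mul_const (Real.exp d)
  have h2 := (aux_int a m d ha).const_mul (m - μ)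
  refine (h.add h2).congr (Filter.Eventually.of_forall fun x => ?_)
  simp only [Real.exp_add, Pi.add_apply]
  ring

lemma aux_val1 (a m d μ : ℝ) (ha : 0 < a) :
    ∫ x : ℝ, (x - μ) * Real.exp (-a * (x - m) ^ 2 + d)
      = (m - μ) * (Real.sqrt (π / a) * Real.exp d) := by
  have h := ((integrable_mul_exp_neg_mul_sq ha).comp_sub_right m).mul_const (Real.exp d)
  have h2 := (aux_int a m d ha).const_mul (m - μ)
  have e : ∀ x : ℝ, (x - μ) * Real.exp (-a * (x - m) ^ 2 + d)
      = (x - m) * Real.exp (-a * (x - m) ^ 2) * Real.exp d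
        + (m - μ) * Real.exp (-a * (x - m) ^ 2 + d) := by
    intro x
    simp only [Real.exp_add]
    ring
  simp only [e]
  rw [integral_add h h2, integral_const_mul, aux_val, integral_mul_const,
    integral_sub_right_eq_self (fun x : ℝ => x * Real.exp (-a * x ^ 2)) m, aux_odd]
  ring

/-- exponent -/
noncomputable def qq (k ε : ℝ) : ℝ :=
  -(1 / 2) * Real.log (1 + (1 + ε) ^ 2) - k * ε ^ 2 / (1 + (1 + ε) ^ 2)

noncomputable def qq' (k ε : ℝ) : ℝ :=
  -(1 + ε) / (1 + (1 + ε) ^ 2) - k * (2 * ((1 + ε) ^ 2 - 1)) / (1 + (1 + ε) ^ 2) ^ 2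

lemma aux_pos (ε : ℝ) : 0 < 1 + (1 + ε) ^ 2 := by positivity

lemma qq_hasDeriv (k ε : ℝ) : HasDerivAt (qq k) (qq' k ε) ε := by
  have hp := aux_pos ε
  have h1 : HasDerivAt (fun ε : ℝ => 1 + (1 + ε) ^ 2) (2 * (1 + ε)) ε := by
    have := (((hasDerivAt_id ε).const_add 1).pow 2).const_add 1
    refine HasDerivAt.congr_deriv this ?_
    simp
  have h2 : HasDerivAt (fun ε : ℝ => k * ε ^ 2) (k * (2 * ε)) ε := by
    have := ((hasDerivAt_id ε).pow 2).const_mul k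
    refine HasDerivAt.congr_deriv this ?_
    simp
  have := ((h1.log hp.ne').const_mul (-(1 / 2))).sub (h2.div h1 hp.ne')
  refine HasDerivAt.congr_deriv this ?_
  unfold qq'
  field_simp
  ring

lemma qq'_hasDeriv (k : ℝ) : HasDerivAt (qq' k) (-k) 0 := by
  have h1 : HasDerivAt (fun ε : ℝ => 1 + (1 + ε) ^ 2) 2 0 := by
    have := (((hasDerivAt_id (0:ℝ)).const_add 1).pow 2).const_add 1
    refine HasDerivAt.congr_deriv this ?_
    simp
  have h2 : HasDerivAt (fun ε : ℝ => -(1 + ε)) (-1) 0 :=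
    ((hasDerivAt_id (0:ℝ)).const_add 1).neg
  have h3 : HasDerivAt (fun ε : ℝ => k * (2 * ((1 + ε) ^ 2 - 1))) (k * (2 * 2)) 0 := by
    have := (((((hasDerivAt_id (0:ℝ)).const_add 1).pow 2).sub_const 1).const_mul 2).const_mul k
    refine HasDerivAt.congr_deriv this ?_
    simp
  have := (h2.div h1 (aux_pos 0).ne').sub (h3.div (h1.pow 2) (pow_ne_zero 2 (aux_pos 0).ne'))
  refine HasDerivAt.congr_deriv this ?_
  norm_num
  ring

lemma sqrt_a (σ ε : ℝ) (hσ : 0 < σ) (k : ℝ) :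
    Real.sqrt (π / ((1 + (1 + ε) ^ 2) / (2 * σ ^ 2))) *
      Real.exp (- k * ε ^ 2 / (1 + (1 + ε) ^ 2)) =
    σ * Real.sqrt 2 * Real.sqrt π * Real.exp (qq k ε) := by
  have hp := aux_pos ε
  have e : π / ((1 + (1 + ε) ^ 2) / (2 * σ ^ 2)) = (σ ^ 2 * 2 * π) / (1 + (1 + ε) ^ 2) := by
    field_simp
  have e2 : Real.exp (-(1 / 2) * Real.log (1 + (1 + ε) ^ 2)) = (Real.sqrt (1 + (1 + ε) ^ 2))⁻¹ := by
    rw [Real.sqrt_eq_rpow, ← Real.rpow_neg hp.le, Real.rpow_def_of_pos hp]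
    congr 1; ring
  unfold qq
  rw [e, Real.sqrt_div (by positivity), Real.sqrt_mul (by positivity),
    Real.sqrt_mul (by positivity), Real.sqrt_sq hσ.le, sub_eq_add_neg, Real.exp_add, e2]
  rw [show -(k * ε ^ 2 / (1 + (1 + ε) ^ 2)) = - k * ε ^ 2 / (1 + (1 + ε) ^ 2) by ring]
  field_simp

lemma cross_eq (μ σ ε x : ℝ) (hσ : 0 < σ) :
    Real.exp (-(x - μ) ^ 2 / (2 * σ ^ 2)) * Real.exp (-((1 + ε) * x - μ) ^ 2 / (2 * σ ^ 2)) =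
    Real.exp (-((1 + (1 + ε) ^ 2) / (2 * σ ^ 2)) * (x - μ * (2 + ε) / (1 + (1 + ε) ^ 2)) ^ 2 +
      - (μ ^ 2 / (2 * σ ^ 2)) * ε ^ 2 / (1 + (1 + ε) ^ 2)) := by
  have hp := aux_pos ε
  rw [← Real.exp_add]
  congr 1
  field_simp
  ring

lemma self_eq (μ σ x : ℝ) (hσ : 0 < σ) :
    Real.exp (-(x - μ) ^ 2 / (2 * σ ^ 2)) * Real.exp (-(x - μ) ^ 2 / (2 * σ ^ 2)) =
    Real.exp (-(1 / σ ^ 2) * (x - μ) ^ 2 + 0) := by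
  rw [← Real.exp_add]
  congr 1
  field_simp
  ring

lemma self_eq' (μ σ ε x : ℝ) (hσ : 0 < σ) (hε : 0 < 1 + ε) :
    Real.exp (-((1 + ε) * x - μ) ^ 2 / (2 * σ ^ 2)) *
      Real.exp (-((1 + ε) * x - μ) ^ 2 / (2 * σ ^ 2)) =
    Real.exp (-((1 + ε) ^ 2 / σ ^ 2) * (x - μ / (1 + ε)) ^ 2 + 0) := by
  rw [← Real.exp_add]
  congr 1
  field_simp
  ring

lemma norm_closed (μ σ ε : ℝ) (hσ : 0 < σ) (hε : 0 < 1 + ε) :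
    normSqFun μ σ ε = σ * Real.sqrt π * (1 + (1 + ε)⁻¹) -
      2 * (σ * Real.sqrt 2 * Real.sqrt π) * Real.exp (qq (μ ^ 2 / (2 * σ ^ 2)) ε) := by
  have hp := aux_pos ε
  unfold normSqFun dopplerDiff
  have e : ∀ x : ℝ, (Real.exp (-(x - μ) ^ 2 / (2 * σ ^ 2)) -
      Real.exp (-((1 + ε) * x - μ) ^ 2 / (2 * σ ^ 2))) ^ 2 =
      Real.exp (-(1 / σ ^ 2) * (x - μ) ^ 2 + 0) +
      Real.exp (-((1 + ε) ^ 2 / σ ^ 2) * (x - μ / (1 + ε)) ^ 2 + 0) -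
      2 * Real.exp (-((1 + (1 + ε) ^ 2) / (2 * σ ^ 2)) *
        (x - μ * (2 + ε) / (1 + (1 + ε) ^ 2)) ^ 2 +
      - (μ ^ 2 / (2 * σ ^ 2)) * ε ^ 2 / (1 + (1 + ε) ^ 2)) := by
    intro x
    rw [← self_eq μ σ x hσ, ← self_eq' μ σ ε x hσ hε, ← cross_eq μ σ ε x hσ]
    ring
  simp only [e]
  have i1 := aux_int (1 / σ ^ 2) μ 0 (by positivity)
  have i2 := aux_int ((1 + ε) ^ 2 / σ ^ 2) (μ / (1 + ε)) 0 (by positivity)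
  have i3 := aux_int ((1 + (1 + ε) ^ 2) / (2 * σ ^ 2)) (μ * (2 + ε) / (1 + (1 + ε) ^ 2))
    (- (μ ^ 2 / (2 * σ ^ 2)) * ε ^ 2 / (1 + (1 + ε) ^ 2)) (by positivity)
  have s1 : Real.sqrt (π / (1 / σ ^ 2)) = σ * Real.sqrt π := by
    rw [show π / (1 / σ ^ 2) = σ ^ 2 * π by field_simp, Real.sqrt_mul (by positivity),
      Real.sqrt_sq hσ.le]
  have s2 : Real.sqrt (π / ((1 + ε) ^ 2 / σ ^ 2)) = σ * Real.sqrt π * (1 + ε)⁻¹ := by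
    rw [show π / ((1 + ε) ^ 2 / σ ^ 2) = (σ * (1 + ε)⁻¹) ^ 2 * π by field_simp,
      Real.sqrt_mul (by positivity), Real.sqrt_sq (by positivity)]
    ring
  have i12 : Integrable (fun x : ℝ => Real.exp (-(1 / σ ^ 2) * (x - μ) ^ 2 + 0) +
      Real.exp (-((1 + ε) ^ 2 / σ ^ 2) * (x - μ / (1 + ε)) ^ 2 + 0)) := i1.add i2
  rw [integral_sub i12 (i3.const_mul 2), integral_add i1 i2, integral_const_mul,
    aux_val, aux_val, aux_val, sqrt_a σ ε hσ, s1, s2, Real.exp_zero]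
  ring

lemma phys1 (x : ℝ) : physHermite 1 x = 2 * x := by
  unfold physHermite
  have h : HasDerivAt (fun t : ℝ => Real.exp (-t ^ 2)) (Real.exp (-x ^ 2) * (-(2 * x))) x := by
    have := ((hasDerivAt_id x).pow 2).neg.exp
    refine HasDerivAt.congr_deriv this ?_
    simp
  rw [iteratedDeriv_one, h.deriv]
  have : Real.exp (x ^ 2) * Real.exp (-x ^ 2) = 1 := by
    rw [← Real.exp_add]; simp
  linear_combination (2 * x) * this

/-- regular factor -/
noncomputable def hh (k ε : ℝ) : ℝ :=
  ((1 + ε) / (1 + (1 + ε) ^ 2) * Real.exp (qq k ε)) ^ 2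

lemma c1_closed (μ σ ε : ℝ) (hσ : 0 < σ) :
    c1SqFun μ σ ε = ε ^ 2 * (4 * Real.sqrt π * μ ^ 2 / σ * hh (μ ^ 2 / (2 * σ ^ 2)) ε) := by
  have hp := aux_pos ε
  unfold c1SqFun hgCoeff hermiteGaussian dopplerDiff
  simp only [phys1]
  set K := (Real.sqrt (σ * 2 ^ 1 * (Nat.factorial 1) * Real.sqrt π))⁻¹ with hK
  have hK2 : K ^ 2 = (2 * σ * Real.sqrt π)⁻¹ := by
    rw [hK, inv_pow, Real.sq_sqrt (by positivity)]
    rw [Nat.factorial_one, Nat.cast_one]; congr 1; ring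
  have e : ∀ x : ℝ, K * (2 * ((x - μ) / σ)) * Real.exp (-(x - μ) ^ 2 / (2 * σ ^ 2)) *
      (Real.exp (-(x - μ) ^ 2 / (2 * σ ^ 2)) -
      Real.exp (-((1 + ε) * x - μ) ^ 2 / (2 * σ ^ 2))) =
      (K * 2 / σ) * ((x - μ) * Real.exp (-(1 / σ ^ 2) * (x - μ) ^ 2 + 0) -
      (x - μ) * Real.exp (-((1 + (1 + ε) ^ 2) / (2 * σ ^ 2)) *
        (x - μ * (2 + ε) / (1 + (1 + ε) ^ 2)) ^ 2 +
      - (μ ^ 2 / (2 * σ ^ 2)) * ε ^ 2 / (1 + (1 + ε) ^ 2))) := by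
    intro x
    rw [← self_eq μ σ x hσ, ← cross_eq μ σ ε x hσ]
    ring
  simp only [e]
  have i1 := aux_int1 (1 / σ ^ 2) μ 0 μ (by positivity)
  have i3 := aux_int1 ((1 + (1 + ε) ^ 2) / (2 * σ ^ 2)) (μ * (2 + ε) / (1 + (1 + ε) ^ 2))
    (- (μ ^ 2 / (2 * σ ^ 2)) * ε ^ 2 / (1 + (1 + ε) ^ 2)) μ (by positivity)
  rw [integral_const_mul, integral_sub i1 i3, aux_val1 _ _ _ _ (by positivity),
    aux_val1 _ _ _ _ (by positivity), sqrt_a σ ε hσ]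
  have em : μ * (2 + ε) / (1 + (1 + ε) ^ 2) - μ = - (μ * ε * ((1 + ε) / (1 + (1 + ε) ^ 2))) := by
    field_simp
    ring
  rw [em]
  unfold hh
  generalize (1 + ε) / (1 + (1 + ε) ^ 2) = r
  generalize Real.exp (qq _ ε) = p
  have s2 : Real.sqrt 2 ^ 2 = 2 := Real.sq_sqrt (by norm_num)
  have sp : 0 < Real.sqrt π := Real.sqrt_pos.2 Real.pi_pos
  have : (K * 2 / σ * ((μ - μ) * (Real.sqrt (π / (1 / σ ^ 2)) * Real.exp 0) -
      -(μ * ε * r) * (σ * Real.sqrt 2 * Real.sqrt π * p))) ^ 2 =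
      K ^ 2 * Real.sqrt 2 ^ 2 * (4 * μ ^ 2 * ε ^ 2 * r ^ 2 * Real.sqrt π ^ 2 * p ^ 2) := by
    field_simp
    ring
  rw [this, hK2, s2]
  field_simp

lemma exp_qq0 (k : ℝ) : Real.exp (qq k 0) = (Real.sqrt 2)⁻¹ := by
  unfold qq
  rw [Real.sqrt_eq_rpow, ← Real.rpow_neg (by norm_num), Real.rpow_def_of_pos (by norm_num)]
  norm_num
  ring

lemma hh0 (k : ℝ) : hh k 0 = 1 / 8 := by
  unfold hh
  rw [exp_qq0, mul_pow, inv_pow, Real.sq_sqrt (by norm_num)]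
  norm_num

lemma hh_smooth (k : ℝ) : ContDiff ℝ 2 (hh k) := by
  have hne : ∀ ε : ℝ, 1 + (1 + ε) ^ 2 ≠ 0 := fun ε => (aux_pos ε).ne'
  have h1 : ContDiff ℝ 2 (fun ε : ℝ => 1 + (1 + ε) ^ 2) := by fun_prop
  have hq : ContDiff ℝ 2 (qq k) := by
    have h2 : ContDiff ℝ 2 (fun ε : ℝ => k * ε ^ 2) := by fun_prop
    exact (contDiff_const.mul (h1.log hne)).sub (h2.div h1 hne)
  have h3 : ContDiff ℝ 2 (fun ε : ℝ => 1 + ε) := by fun_prop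
  exact ((h3.div h1 hne).mul hq.exp).pow 2

open Filter in
lemma lhop (f g f' g' : ℝ → ℝ) (A B : ℝ) (hB : B ≠ 0)
    (hf : ∀ᶠ x in nhds 0, HasDerivAt f (f' x) x) (hg : ∀ᶠ x in nhds 0, HasDerivAt g (g' x) x)
    (hf0 : f 0 = 0) (hg0 : g 0 = 0) (hf'0 : f' 0 = 0) (hg'0 : g' 0 = 0)
    (hf' : HasDerivAt f' A 0) (hg' : HasDerivAt g' B 0) :
    Tendsto (fun x => f x / g x) (nhdsWithin 0 {(0 : ℝ)}ᶜ) (nhds (A / B)) := by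
  have sf := hasDerivAt_iff_tendsto_slope.1 hf'
  have sg := hasDerivAt_iff_tendsto_slope.1 hg'
  have hne : ∀ᶠ x in nhdsWithin 0 {(0 : ℝ)}ᶜ, g' x ≠ 0 := by
    filter_upwards [sg.eventually_ne hB] with x hx h
    apply hx
    simp [slope_def_field, h, hg'0]
  refine HasDerivAt.lhopital_zero_nhdsNE (f' := f') (g' := g')
    (hf.filter_mono nhdsWithin_le_nhds) (hg.filter_mono nhdsWithin_le_nhds) hne ?_ ?_ ?_
  · have := hf.self_of_nhds.continuousAt.tendsto
    rw [hf0] at this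
    exact this.mono_left nhdsWithin_le_nhds
  · have := hg.self_of_nhds.continuousAt.tendsto
    rw [hg0] at this
    exact this.mono_left nhdsWithin_le_nhds
  · refine (sf.div sg hB).congr' ?_
    filter_upwards [self_mem_nhdsWithin] with x hx
    have hx : x ≠ 0 := hx
    simp only [Pi.div_apply, slope_def_field, hf'0, hg'0, sub_zero]
    field_simp

open Filter in
theorem lhopital_ratio_limit (μ σ : ℝ) (hσ : 0 < σ) :
    c1SqFun μ σ 0 = 0 ∧ deriv (c1SqFun μ σ) 0 = 0 ∧
      normSqFun μ σ 0 = 0 ∧ deriv (normSqFun μ σ) 0 = 0 ∧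
      deriv (deriv (c1SqFun μ σ)) 0 = Real.sqrt Real.pi * μ ^ 2 / σ ∧
      deriv (deriv (normSqFun μ σ)) 0 =
        Real.sqrt Real.pi * μ ^ 2 / σ + 3 * σ * Real.sqrt Real.pi / 2 ∧
      Tendsto (fun ε : ℝ => c1SqFun μ σ ε / normSqFun μ σ ε)
        (nhdsWithin 0 {(0 : ℝ)}ᶜ)
        (nhds ((Real.sqrt Real.pi * μ ^ 2 / σ) /
          (Real.sqrt Real.pi * μ ^ 2 / σ + 3 * σ * Real.sqrt Real.pi / 2))) := by
  have sp : 0 < Real.sqrt π := Real.sqrt_pos.2 Real.pi_pos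
  have s2p : 0 < Real.sqrt 2 := Real.sqrt_pos.2 (by norm_num)
  set k := μ ^ 2 / (2 * σ ^ 2) with hk
  set C := 4 * Real.sqrt π * μ ^ 2 / σ with hC
  -- the numerator
  have cf : c1SqFun μ σ = fun ε => ε ^ 2 * (C * hh k ε) := funext fun ε => c1_closed μ σ ε hσ
  have hs := hh_smooth k
  have hd : Differentiable ℝ (hh k) := hs.differentiable (by norm_num)
  have hdd : Differentiable ℝ (deriv (hh k)) := by
    have : ContDiff ℝ 1 (deriv (hh k)) := by
      have := (contDiff_succ_iff_deriv (n := 1) (f := hh k)).1 (by rw [one_add_one_eq_two]; exact hs)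
      exact this.2.2
    exact this.differentiable (by norm_num)
  have cd : ∀ ε, HasDerivAt (c1SqFun μ σ)
      (2 * ε * (C * hh k ε) + ε ^ 2 * (C * deriv (hh k) ε)) ε := by
    intro ε
    rw [cf]
    have := ((hasDerivAt_id ε).pow 2).mul ((hd ε).hasDerivAt.const_mul C)
    refine HasDerivAt.congr_deriv this ?_
    simp
  have cdd : HasDerivAt (fun ε => 2 * ε * (C * hh k ε) + ε ^ 2 * (C * deriv (hh k) ε))
      (Real.sqrt Real.pi * μ ^ 2 / σ) 0 := by
    have := ((((hasDerivAt_id (0:ℝ)).const_mul 2).mul ((hd 0).hasDerivAt.const_mul C))).add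
      (((hasDerivAt_id (0:ℝ)).pow 2).mul ((hdd 0).hasDerivAt.const_mul C))
    refine HasDerivAt.congr_deriv this ?_
    simp [hh0, hC]
    ring
  -- the denominator
  have hev : ∀ᶠ ε : ℝ in nhds 0, 0 < 1 + ε := by
    filter_upwards [lt_mem_nhds (show (-1 : ℝ) < 0 by norm_num)] with ε h
    linarith
  have nd : ∀ᶠ ε : ℝ in nhds 0, HasDerivAt (normSqFun μ σ)
      (σ * Real.sqrt π * (-((1 + ε) ^ 2)⁻¹) -
      2 * (σ * Real.sqrt 2 * Real.sqrt π) * (Real.exp (qq k ε) * qq' k ε)) ε := by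
    filter_upwards [hev, hev.eventually_nhds] with ε h h'
    have h1 : HasDerivAt (fun ε : ℝ => (1 + ε)⁻¹) (-((1 + ε) ^ 2)⁻¹) ε := by
      have := ((hasDerivAt_id ε).const_add 1).inv h.ne'
      refine HasDerivAt.congr_deriv this ?_
      simp [neg_div]
    have := ((h1.const_add 1).const_mul (σ * Real.sqrt π)).sub
      ((qq_hasDeriv k ε).exp.const_mul (2 * (σ * Real.sqrt 2 * Real.sqrt π)))
    refine this.congr_of_eventuallyEq ?_
    filter_upwards [h'] with x hx
    exact norm_closed μ σ x hσ hx
  have q0 : qq' k 0 = -1 / 2 := by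
    unfold qq'; norm_num
  have ndd : HasDerivAt (fun ε : ℝ => σ * Real.sqrt π * (-((1 + ε) ^ 2)⁻¹) -
      2 * (σ * Real.sqrt 2 * Real.sqrt π) * (Real.exp (qq k ε) * qq' k ε))
      (Real.sqrt Real.pi * μ ^ 2 / σ + 3 * σ * Real.sqrt Real.pi / 2) 0 := by
    have h1 : HasDerivAt (fun ε : ℝ => ((1 + ε) ^ 2)⁻¹) (-2) 0 := by
      have := (((hasDerivAt_id (0:ℝ)).const_add 1).pow 2).inv (by norm_num)
      refine HasDerivAt.congr_deriv this ?_
      simp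
    have := (h1.neg.const_mul (σ * Real.sqrt π)).sub
      (((qq_hasDeriv k 0).exp.mul (qq'_hasDeriv k)).const_mul
        (2 * (σ * Real.sqrt 2 * Real.sqrt π)))
    refine HasDerivAt.congr_deriv this ?_
    rw [exp_qq0, q0, hk]
    field_simp
    ring
  have c0 : c1SqFun μ σ 0 = 0 := by rw [cf]; simp
  have n0 : normSqFun μ σ 0 = 0 := by simp [normSqFun, dopplerDiff]
  have nd0 : σ * Real.sqrt π * (-((1 + (0:ℝ)) ^ 2)⁻¹) -
      2 * (σ * Real.sqrt 2 * Real.sqrt π) * (Real.exp (qq k 0) * qq' k 0) = 0 := by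
    rw [exp_qq0, q0]
    field_simp
    ring
  refine ⟨c0, ?_, n0, ?_, ?_, ?_, ?_⟩
  · rw [(cd 0).deriv]; simp
  · rw [nd.self_of_nhds.deriv, nd0]
  · rw [show deriv (c1SqFun μ σ) = _ from funext fun ε => (cd ε).deriv]
    exact cdd.deriv
  · refine (ndd.congr_of_eventuallyEq ?_).deriv
    filter_upwards [nd] with x hx
    exact hx.deriv
  · refine lhop _ _ _ _ _ _ ?_ (Eventually.of_forall cd) nd c0 n0 (by simp) nd0 cdd ndd
    have : 0 ≤ Real.sqrt Real.pi * μ ^ 2 / σ := by positivity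
    have : 0 < 3 * σ * Real.sqrt Real.pi / 2 := by positivity
    linarith
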